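/- Let n ≥ 1 and let Z be the n-fold product of the standard real Gaussian measure (gaussianReal 0 1) on ℝⁿ. Then the pushforward of Z under the map z ↦ Σ_{i} z_i² equals the Gamma distribution on ℝ with shape parameter n/2 and rate parameter 1/2 (the chi-square distribution with n degrees of freedom). Consequently, if L is an invertible n×n matrix, μ ∈ ℝⁿ, γ is the pushforward of Z under z ↦ μ + L·z, and Σ = L Lᵀ, then the pushforward of γ under x ↦ (x − μ)ᵀ Σ⁻¹ (x − μ) is also this Gamma(n/2, 1/2) distribution; hence γ assigns to the ellipsoid E_κ = {y : (y − μ)ᵀ Σ⁻¹ (y − μ) ≤ κ} the probability given by the chi-square cumulative distribution function with n degrees of freedom evaluated at κ. -/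

import Mathlib

open MeasureTheory ProbabilityTheory Matrix

lemma aux_ext_of_mgf {P Q : Measure ℝ} [IsProbabilityMeasure P] [IsProbabilityMeasure Q]
    {c : ℝ} (hc : 0 < c) (h : ∀ t < c, mgf id P t = mgf id Q t)
    (hpos : ∀ t < c, 0 < mgf id P t) : P = Q := by
  have hPs : Set.Iio c ⊆ interior (integrableExpSet id P) := by
    refine interior_maximal (fun t ht => ?_) isOpen_Iio
    by_contra hn
    have := hpos t ht
    rw [mgf_undef hn] at this
    exact lt_irrefl _ this
  have hQs : Set.Iio c ⊆ interior (integrableExpSet id Q) := by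
    refine interior_maximal (fun t ht => ?_) isOpen_Iio
    by_contra hn
    have := hpos t ht
    rw [h t ht, mgf_undef hn] at this
    exact lt_irrefl _ this
  have hX : AnalyticOnNhd ℂ (complexMGF id P) {z | z.re ∈ Set.Iio c} :=
    analyticOnNhd_complexMGF.mono fun z hz => hPs hz
  have hY : AnalyticOnNhd ℂ (complexMGF id Q) {z | z.re ∈ Set.Iio c} :=
    analyticOnNhd_complexMGF.mono fun z hz => hQs hz
  have key : Set.EqOn (complexMGF id P) (complexMGF id Q) {z | z.re ∈ Set.Iio c} := by
    refine AnalyticOnNhd.eqOn_of_preconnected_of_frequently_eq hX hY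
      ((convex_Iio c).linear_preimage Complex.reLm).isPreconnected
      (z₀ := ((0 : ℝ) : ℂ)) (by simpa using hc) ?_
    have h_real : ∃ᶠ (x : ℝ) in nhdsWithin 0 {0}ᶜ,
        complexMGF id P x = complexMGF id Q x := by
      refine Filter.Eventually.frequently ?_
      have : ∀ᶠ x : ℝ in nhdsWithin 0 {0}ᶜ, x < c :=
        Filter.Eventually.filter_mono nhdsWithin_le_nhds (eventually_lt_nhds hc)
      filter_upwards [this] with y hy
      rw [complexMGF_ofReal, complexMGF_ofReal, h y hy]
    rw [Filter.frequently_iff_seq_forall] at h_real ⊢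
    obtain ⟨xs, hx_tendsto, hx_eq⟩ := h_real
    refine ⟨fun n ↦ xs n, ?_, fun n ↦ ?_⟩
    · rw [tendsto_nhdsWithin_iff] at hx_tendsto ⊢
      constructor
      · exact (Complex.continuous_ofReal.tendsto 0).comp hx_tendsto.1
      · simpa using hx_tendsto.2
    · simp [hx_eq]
  refine Measure.ext_of_charFun ?_
  ext t
  rw [← complexMGF_id_mul_I, ← complexMGF_id_mul_I]
  exact key (by simpa using hc)

lemma aux_mgf_gamma {a r t : ℝ} (ha : 0 < a) (hr : 0 < r) (ht : t < r) :
    mgf id (gammaMeasure a r) t = (r / (r - t)) ^ a := by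
  have hrt : 0 < r - t := by linarith
  have hG := Real.Gamma_pos_of_pos ha
  have hm : Measurable (gammaPDF a r) := (measurable_gammaPDFReal a r).ennreal_ofReal
  rw [mgf, gammaMeasure, integral_withDensity_eq_integral_toReal_smul hm
    (Filter.Eventually.of_forall fun x => ENNReal.ofReal_lt_top)]
  have h1 : ∀ x : ℝ, (gammaPDF a r x).toReal • Real.exp (t * id x) =
      (Set.Ici (0 : ℝ)).indicator (fun x => r ^ a / Real.Gamma a *
        (x ^ (a - 1) * Real.exp (-((r - t) * x)))) x := by
    intro x
    rw [gammaPDF, ENNReal.toReal_ofReal (gammaPDFReal_nonneg ha hr x), gammaPDFReal]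
    by_cases hx : 0 ≤ x
    · rw [if_pos hx, Set.indicator_of_mem (by exact hx), smul_eq_mul, id,
        show -((r - t) * x) = -(r * x) + t * x by ring, Real.exp_add]
      ring
    · rw [if_neg hx, Set.indicator_of_notMem (by exact hx), zero_smul]
  simp_rw [h1]
  rw [integral_indicator measurableSet_Ici, integral_Ici_eq_integral_Ioi, integral_const_mul,
    Real.integral_rpow_mul_exp_neg_mul_Ioi ha hrt, Real.div_rpow hr.le hrt.le,
    Real.div_rpow zero_le_one hrt.le, Real.one_rpow]
  field_simp

lemma aux_mgf_sq {t : ℝ} (ht : t < 1 / 2) :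
    ∫ x, Real.exp (t * x ^ 2) ∂(gaussianReal 0 1) = √((1 / 2) / (1 / 2 - t)) := by
  rw [integral_gaussianReal_eq_integral_smul one_ne_zero]
  have h1 : ∀ x : ℝ, gaussianPDFReal 0 1 x • Real.exp (t * x ^ 2) =
      (√(2 * Real.pi))⁻¹ * Real.exp (-(1 / 2 - t) * x ^ 2) := by
    intro x
    simp only [gaussianPDFReal, smul_eq_mul, NNReal.coe_one, mul_one, sub_zero]
    rw [mul_assoc, ← Real.exp_add]
    congr 2
    ring
  simp_rw [h1]
  have hrt : 0 < 1 / 2 - t := by linarith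
  have hpi := Real.pi_pos
  rw [integral_const_mul, integral_gaussian, ← Real.sqrt_inv, ← Real.sqrt_mul (by positivity)]
  congr 1
  field_simp

lemma aux_chi {n : ℕ} (hn : 1 ≤ n) :
    Measure.map (fun z : Fin n → ℝ => ∑ i, z i ^ 2)
      (Measure.pi fun _ : Fin n => gaussianReal 0 1) = gammaMeasure ((n : ℝ) / 2) (1 / 2) := by
  have ha : (0 : ℝ) < (n : ℝ) / 2 := by
    have : (0 : ℝ) < n := by exact_mod_cast hn
    positivity
  have hm : Measurable (fun z : Fin n → ℝ => ∑ i, z i ^ 2) := by fun_prop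
  have := isProbabilityMeasure_gammaMeasure ha (r := 1 / 2) (by norm_num)
  have := Measure.isProbabilityMeasure_map (μ := Measure.pi fun _ : Fin n => gaussianReal 0 1)
    hm.aemeasurable
  have hL : ∀ t < (1 / 2 : ℝ), mgf id (Measure.map (fun z : Fin n → ℝ => ∑ i, z i ^ 2)
      (Measure.pi fun _ : Fin n => gaussianReal 0 1)) t
        = ((1 / 2) / (1 / 2 - t)) ^ ((n : ℝ) / 2) := by
    intro t ht
    have hrt : 0 < 1 / 2 - t := by linarith
    rw [mgf_id_map hm.aemeasurable, mgf]
    simp_rw [Finset.mul_sum, Real.exp_sum]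
    rw [integral_fintype_prod_eq_pow (fun x : ℝ => Real.exp (t * x ^ 2)), aux_mgf_sq ht,
      Fintype.card_fin, Real.sqrt_eq_rpow, ← Real.rpow_mul_natCast (by positivity)]
    congr 1
    ring
  refine aux_ext_of_mgf (c := 1 / 2) (by norm_num) (fun t ht => ?_) (fun t ht => ?_)
  · rw [hL t ht, aux_mgf_gamma ha (by norm_num) ht]
  · have hrt : 0 < 1 / 2 - t := by linarith
    rw [hL t ht]
    positivity

/-- The pushforward of the `n`-fold product of standard Gaussians under `z ↦ ∑ i, z i ^ 2`
is the Gamma distribution with shape `n/2` and rate `1/2` (the chi-square distribution with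
`n` degrees of freedom). Consequently, for a Gaussian measure `γ` with mean `μ` and
invertible covariance factor `L` (so `Σ = L Lᵀ`), the Mahalanobis square
`x ↦ (x − μ)ᵀ Σ⁻¹ (x − μ)` is chi-square with `n` degrees of freedom, and the ellipsoid
`E_κ = {y : (y − μ)ᵀ Σ⁻¹ (y − μ) ≤ κ}` has probability equal to the chi-square CDF at `κ`. -/
theorem gaussian_mahalanobis_chiSquare
    {n : ℕ} (hn : 1 ≤ n)
    (Z : Measure (Fin n → ℝ))
    (hZ : Z = Measure.pi fun _ : Fin n => gaussianReal 0 1) :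
    Measure.map (fun z : Fin n → ℝ => ∑ i, z i ^ 2) Z =
      gammaMeasure ((n : ℝ) / 2) (1 / 2) ∧
    ∀ (L : Matrix (Fin n) (Fin n) ℝ), IsUnit L.det →
      ∀ (μ : Fin n → ℝ) (γ : Measure (Fin n → ℝ)),
        γ = Measure.map (fun z : Fin n → ℝ => μ + L.mulVec z) Z →
        ∀ S : Matrix (Fin n) (Fin n) ℝ, S = L * Lᵀ →
          Measure.map (fun x : Fin n → ℝ => (x - μ) ⬝ᵥ S⁻¹.mulVec (x - μ)) γ =
            gammaMeasure ((n : ℝ) / 2) (1 / 2) ∧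
          ∀ κ : ℝ, γ {y | (y - μ) ⬝ᵥ S⁻¹.mulVec (y - μ) ≤ κ} =
            gammaMeasure ((n : ℝ) / 2) (1 / 2) (Set.Iic κ) := by
  subst hZ
  refine ⟨aux_chi hn, ?_⟩
  intro L hL μ γ hγ S hS
  subst hγ hS
  have hq : Measurable (fun x : Fin n → ℝ => (x - μ) ⬝ᵥ (L * Lᵀ)⁻¹.mulVec (x - μ)) := by
    simp only [dotProduct, mulVec]
    fun_prop
  have hA : Measurable (fun z : Fin n → ℝ => μ + L.mulVec z) := by
    exact (continuous_const.add (continuous_const.matrix_mulVec continuous_id)).measurable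
  have hmain : Measure.map (fun x : Fin n → ℝ => (x - μ) ⬝ᵥ (L * Lᵀ)⁻¹.mulVec (x - μ))
      (Measure.map (fun z : Fin n → ℝ => μ + L.mulVec z)
        (Measure.pi fun _ : Fin n => gaussianReal 0 1)) =
      gammaMeasure ((n : ℝ) / 2) (1 / 2) := by
    rw [Measure.map_map hq hA, ← aux_chi hn]
    congr 1
    funext z
    have hLt : IsUnit Lᵀ.det := by rwa [det_transpose]
    have h2 : (L * Lᵀ)⁻¹ *ᵥ (L *ᵥ z) = Lᵀ⁻¹ *ᵥ z := by
      rw [mulVec_mulVec, Matrix.mul_inv_rev, Matrix.mul_assoc, nonsing_inv_mul _ hL,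
        Matrix.mul_one]
    simp only [Function.comp, add_sub_cancel_left]
    rw [h2, dotProduct_mulVec, ← mulVec_transpose, mulVec_mulVec, ← transpose_nonsing_inv,
      transpose_transpose, nonsing_inv_mul _ hL, one_mulVec]
    simp [dotProduct, pow_two]
  refine ⟨hmain, fun κ => ?_⟩
  rw [← hmain, Measure.map_apply hq measurableSet_Iic]
  rfl
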